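/- Let s > 1, R > 0, and let f ∈ C^∞(R^n) satisfy |∂_x^α f(x)| ≤ C R^{|α|} α!^s ⟨x⟩^{a−|α|}. With N = ⌊(Rw)^{−1/(s-1)}⌋ and f̃ the almost analytic extension, for each j and each pair α, β there exist C > 0 and l > 0 such that for all w ∈ (0,1] and all x+iy in the strip S_w, |∂_x^α ∂_y^β (∂_{x_j} + i ∂_{y_j}) f̃(x+iy)| ≤ C w^{−l} exp(−Ω/w^{1/(s-1)}) ⟨x⟩^{a−|α+β|−1}, where Ω = (s−1)/R^{1/(s-1)}. -/

import Mathlib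

/-- Japanese bracket ⟨x⟩ = (1 + |x|²)^{1/2} on ℝⁿ. -/
noncomputable def jb {n : ℕ} (x : Fin n → ℝ) : ℝ := Real.sqrt (1 + ∑ i, (x i) ^ 2)

/-- Partial derivative in the j-th coordinate direction. -/
noncomputable def pd {n : ℕ} (j : Fin n) (f : (Fin n → ℝ) → ℝ) : (Fin n → ℝ) → ℝ :=
  fun x => fderiv ℝ f x (Pi.single j 1)

/-- Multi-index partial derivative ∂^α. -/
noncomputable def mderiv {n : ℕ} (α : Fin n → ℕ) (f : (Fin n → ℝ) → ℝ) : (Fin n → ℝ) → ℝ :=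
  (List.finRange n).foldr (fun j g => (pd j)^[α j] g) f

/-- Almost analytic extension of order N:
    f̃(x+iy) = ∑_{|α| ≤ N} (iy)^α/α! ∂^α f(x), viewed as a function of (x, y). -/
noncomputable def aae {n : ℕ} (N : ℕ) (f : (Fin n → ℝ) → ℝ) :
    (Fin n → ℝ) → (Fin n → ℝ) → ℂ := fun x y =>
  ∑ α ∈ Finset.univ.filter (fun α : Fin n → Fin (N + 1) => ∑ i, (α i : ℕ) ≤ N),
    (∏ i, (Complex.I * (y i : ℂ)) ^ (α i : ℕ)) /
      ((∏ i, Nat.factorial (α i : ℕ) : ℕ) : ℂ) * ((mderiv (fun i => (α i : ℕ)) f x : ℝ) : ℂ)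

/-- x-partial derivative of a two-variable complex-valued function. -/
noncomputable def pdx {n : ℕ} (j : Fin n) (g : (Fin n → ℝ) → (Fin n → ℝ) → ℂ) :
    (Fin n → ℝ) → (Fin n → ℝ) → ℂ :=
  fun x y => fderiv ℝ (fun x' => g x' y) x (Pi.single j 1)

/-- y-partial derivative of a two-variable complex-valued function. -/
noncomputable def pdy {n : ℕ} (j : Fin n) (g : (Fin n → ℝ) → (Fin n → ℝ) → ℂ) :
    (Fin n → ℝ) → (Fin n → ℝ) → ℂ :=
  fun x y => fderiv ℝ (fun y' => g x y') y (Pi.single j 1)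

/-- Multi-index x-derivative ∂_x^α. -/
noncomputable def mdx {n : ℕ} (α : Fin n → ℕ) (g : (Fin n → ℝ) → (Fin n → ℝ) → ℂ) :
    (Fin n → ℝ) → (Fin n → ℝ) → ℂ :=
  (List.finRange n).foldr (fun j G => (pdx j)^[α j] G) g

/-- Multi-index y-derivative ∂_y^β. -/
noncomputable def mdy {n : ℕ} (β : Fin n → ℕ) (g : (Fin n → ℝ) → (Fin n → ℝ) → ℂ) :
    (Fin n → ℝ) → (Fin n → ℝ) → ℂ :=
  (List.finRange n).foldr (fun j G => (pdy j)^[β j] G) g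


lemma pd_smooth {n : ℕ} (j : Fin n) {g : (Fin n → ℝ) → ℝ} (hg : ContDiff ℝ (⊤ : ℕ∞) g) :
    ContDiff ℝ (⊤ : ℕ∞) (pd j g) := by
  unfold pd
  have h1 : ContDiff ℝ (⊤ : ℕ∞) (fderiv ℝ g) := hg.fderiv_right (by norm_cast)
  exact h1.clm_apply contDiff_const

lemma pd_iter_smooth {n : ℕ} (j : Fin n) (m : ℕ) {g : (Fin n → ℝ) → ℝ}
    (hg : ContDiff ℝ (⊤ : ℕ∞) g) :
    ContDiff ℝ (⊤ : ℕ∞) ((pd j)^[m] g) := by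
  induction m with
  | zero => simpa using hg
  | succ m ih => rw [Function.iterate_succ_apply']; exact pd_smooth j ih

lemma pd_comm {n : ℕ} (j k : Fin n) {g : (Fin n → ℝ) → ℝ} (hg : ContDiff ℝ (⊤ : ℕ∞) g) :
    pd j (pd k g) = pd k (pd j g) := by
  have h1 : ContDiff ℝ (⊤ : ℕ∞) (fderiv ℝ g) := hg.fderiv_right (by norm_cast)
  have hd : Differentiable ℝ (fderiv ℝ g) := h1.differentiable (by simp)
  have key : ∀ (v w : Fin n → ℝ) (x : Fin n → ℝ),
      fderiv ℝ (fun x => fderiv ℝ g x v) x w = fderiv ℝ (fderiv ℝ g) x w v := by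
    intro v w x
    rw [fderiv_clm_apply (hd x) (differentiableAt_const v)]
    simp
  funext x
  unfold pd
  rw [key, key]
  have hs : IsSymmSndFDerivAt ℝ g x := by
    apply (hg.contDiffAt).isSymmSndFDerivAt
    simp
    norm_cast
  exact hs _ _

lemma pd_iter_comm {n : ℕ} (j k : Fin n) (m : ℕ) {g : (Fin n → ℝ) → ℝ}
    (hg : ContDiff ℝ (⊤ : ℕ∞) g) :
    pd j ((pd k)^[m] g) = (pd k)^[m] (pd j g) := by
  induction m with
  | zero => rfl
  | succ m ih =>
    rw [Function.iterate_succ_apply', Function.iterate_succ_apply', pd_comm j k (pd_iter_smooth k m hg), ih]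

lemma foldr_smooth {n : ℕ} (l : List (Fin n)) (α : Fin n → ℕ) {f : (Fin n → ℝ) → ℝ}
    (hf : ContDiff ℝ (⊤ : ℕ∞) f) :
    ContDiff ℝ (⊤ : ℕ∞) (l.foldr (fun j g => (pd j)^[α j] g) f) := by
  induction l with
  | nil => simpa using hf
  | cons k l ih => simp only [List.foldr_cons]; exact pd_iter_smooth k _ ih

lemma mderiv_smooth {n : ℕ} (α : Fin n → ℕ) {f : (Fin n → ℝ) → ℝ}
    (hf : ContDiff ℝ (⊤ : ℕ∞) f) : ContDiff ℝ (⊤ : ℕ∞) (mderiv α f) :=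
  foldr_smooth _ α hf

lemma foldr_congr_notMem {n : ℕ} (l : List (Fin n)) (α : Fin n → ℕ) (j : Fin n) (hj : j ∉ l)
    (f : (Fin n → ℝ) → ℝ) :
    l.foldr (fun k g => (pd k)^[(α + Pi.single j 1 : Fin n → ℕ) k] g) f =
      l.foldr (fun k g => (pd k)^[α k] g) f := by
  induction l with
  | nil => rfl
  | cons k l ih =>
    simp only [List.mem_cons, not_or] at hj
    simp only [List.foldr_cons]
    rw [ih hj.2]
    have : (α + Pi.single j 1 : Fin n → ℕ) k = α k := by
      simp [Pi.single_apply, Ne.symm hj.1]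
    rw [this]

lemma pd_foldr {n : ℕ} (l : List (Fin n)) (hl : l.Nodup) (α : Fin n → ℕ) (j : Fin n) (hj : j ∈ l)
    {f : (Fin n → ℝ) → ℝ} (hf : ContDiff ℝ (⊤ : ℕ∞) f) :
    pd j (l.foldr (fun k g => (pd k)^[α k] g) f) =
      l.foldr (fun k g => (pd k)^[(α + Pi.single j 1 : Fin n → ℕ) k] g) f := by
  induction l with
  | nil => simp at hj
  | cons k l ih =>
    rw [List.nodup_cons] at hl
    simp only [List.foldr_cons]
    by_cases hk : j = k
    · subst hk
      rw [foldr_congr_notMem l α j hl.1]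
      have : (α + Pi.single j 1 : Fin n → ℕ) j = α j + 1 := by simp
      rw [this, Function.iterate_succ_apply']
    · have hj' : j ∈ l := by
        rcases List.mem_cons.1 hj with h | h
        · exact absurd h hk
        · exact h
      rw [pd_iter_comm j k _ (foldr_smooth l α hf), ih hl.2 hj']
      have : (α + Pi.single j 1 : Fin n → ℕ) k = α k := by
        simp [Pi.single_apply, Ne.symm hk]
      rw [this]

lemma pd_mderiv {n : ℕ} (α : Fin n → ℕ) (j : Fin n)
    {f : (Fin n → ℝ) → ℝ} (hf : ContDiff ℝ (⊤ : ℕ∞) f) :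
    pd j (mderiv α f) = mderiv (α + Pi.single j 1) f :=
  pd_foldr _ (List.nodup_finRange n) α j (List.mem_finRange j) hf

/-- one-variable factor -/
noncomputable def ef (g b : ℕ) (t : ℝ) : ℂ :=
  (g.descFactorial b : ℂ) * Complex.I ^ b * (Complex.I * (t : ℂ)) ^ (g - b) / (g.factorial : ℂ)

lemma ef_hasDerivAt (g b : ℕ) (t : ℝ) : HasDerivAt (ef g b) (ef g (b + 1) t) t := by
  have h1 : HasDerivAt (fun t : ℝ => Complex.I * (t : ℂ)) Complex.I t := by
    simpa using (Complex.ofRealCLM.hasDerivAt (x := t)).const_mul Complex.I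
  have h2 := ((h1.pow (g - b)).const_mul ((g.descFactorial b : ℂ) * Complex.I ^ b)).div_const
    (g.factorial : ℂ)
  have h3 : HasDerivAt (ef g b) _ t := h2
  refine h3.congr_deriv ?_
  unfold ef
  rw [Nat.descFactorial_succ, Nat.sub_sub]
  push_cast
  ring

/-- product of the one-variable factors -/
noncomputable def Ef {n : ℕ} (g b : Fin n → ℕ) (y : Fin n → ℝ) : ℂ := ∏ i, ef (g i) (b i) (y i)

lemma Ef_fderiv {n : ℕ} (g b : Fin n → ℕ) (y : Fin n → ℝ) (j : Fin n) :
    DifferentiableAt ℝ (Ef g b) y ∧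
    fderiv ℝ (Ef g b) y (Pi.single j 1) = Ef g (b + Pi.single j 1) y := by
  have h1 : ∀ i ∈ (Finset.univ : Finset (Fin n)), HasFDerivAt (fun y : Fin n → ℝ => ef (g i) (b i) (y i))
      ((ContinuousLinearMap.toSpanSingleton ℝ (ef (g i) (b i + 1) (y i))).comp
        (ContinuousLinearMap.proj (R := ℝ) (φ := fun _ : Fin n => ℝ) i)) y := by
    intro i _
    exact (ef_hasDerivAt (g i) (b i) (y i)).hasFDerivAt.comp y
      (ContinuousLinearMap.proj (R := ℝ) (φ := fun _ : Fin n => ℝ) i).hasFDerivAt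
  have h2 := HasFDerivAt.finsetProd h1
  have h3 : HasFDerivAt (Ef g b) _ y := h2
  refine ⟨h3.differentiableAt, ?_⟩
  rw [h3.fderiv]
  simp only [sum_apply, smul_apply,
    ContinuousLinearMap.comp_apply, ContinuousLinearMap.proj_apply,
    ContinuousLinearMap.toSpanSingleton_apply]
  rw [Finset.sum_eq_single j]
  · unfold Ef
    rw [← Finset.mul_prod_erase Finset.univ _ (Finset.mem_univ j)]
    simp only [Pi.single_eq_same, one_smul, smul_eq_mul, Pi.add_apply]
    rw [mul_comm]
    congr 1
    apply Finset.prod_congr rfl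
    intro i hi
    have := Finset.ne_of_mem_erase hi
    simp [Pi.single_apply, this]
  · intro i _ hi
    simp [Pi.single_apply, hi]
  · simp

/-- the general finite sum -/
noncomputable def Fs {n : ℕ} (f : (Fin n → ℝ) → ℝ) (T : Finset (Fin n → ℕ)) (a b : Fin n → ℕ) :
    (Fin n → ℝ) → (Fin n → ℝ) → ℂ := fun x y =>
  ∑ g ∈ T, Ef g b y * ((mderiv (g + a) f x : ℝ) : ℂ)

lemma pdx_Fs {n : ℕ} {f : (Fin n → ℝ) → ℝ} (hf : ContDiff ℝ (⊤ : ℕ∞) f)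
    (T : Finset (Fin n → ℕ)) (a b : Fin n → ℕ) (j : Fin n) :
    pdx j (Fs f T a b) = Fs f T (a + Pi.single j 1) b := by
  funext x y
  unfold pdx Fs
  have h1 : ∀ g ∈ T, HasFDerivAt (fun x' => Ef g b y * ((mderiv (g + a) f x' : ℝ) : ℂ))
      (Ef g b y • (Complex.ofRealCLM.comp (fderiv ℝ (mderiv (g + a) f) x))) x := by
    intro g _
    have hd : HasFDerivAt (mderiv (g + a) f) (fderiv ℝ (mderiv (g + a) f) x) x :=
      (((mderiv_smooth (g + a) hf).differentiable (by simp)) x).hasFDerivAt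
    exact (Complex.ofRealCLM.hasFDerivAt.comp x hd).const_mul (Ef g b y)
  rw [(HasFDerivAt.fun_sum h1).fderiv]
  simp only [sum_apply, smul_apply,
    ContinuousLinearMap.comp_apply, Complex.ofRealCLM_apply, smul_eq_mul]
  apply Finset.sum_congr rfl
  intro g _
  rw [← add_assoc, ← pd_mderiv _ _ hf]
  rfl

lemma pdy_Fs {n : ℕ} (f : (Fin n → ℝ) → ℝ)
    (T : Finset (Fin n → ℕ)) (a b : Fin n → ℕ) (j : Fin n) :
    pdy j (Fs f T a b) = Fs f T a (b + Pi.single j 1) := by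
  funext x y
  unfold pdy Fs
  have h1 : ∀ g ∈ T, HasFDerivAt (fun y' => Ef g b y' * ((mderiv (g + a) f x : ℝ) : ℂ))
      (((mderiv (g + a) f x : ℝ) : ℂ) • (fderiv ℝ (Ef g b) y)) y := by
    intro g _
    exact (Ef_fderiv g b y j).1.hasFDerivAt.mul_const _
  rw [(HasFDerivAt.fun_sum h1).fderiv]
  simp only [sum_apply, smul_apply, smul_eq_mul]
  apply Finset.sum_congr rfl
  intro g _
  rw [(Ef_fderiv g b y j).2, mul_comm]

lemma iter_shift {n : ℕ} {X : Type*} (D : X → X) (G : (Fin n → ℕ) → X) (j : Fin n)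
    (h : ∀ a, D (G a) = G (a + Pi.single j 1)) (m : ℕ) (a : Fin n → ℕ) :
    D^[m] (G a) = G (a + Pi.single j m) := by
  induction m with
  | zero => simp
  | succ m ih =>
    rw [Function.iterate_succ_apply', ih, h, add_assoc, ← Pi.single_add]

lemma foldr_shift {n : ℕ} {X : Type*} (D : Fin n → X → X) (G : (Fin n → ℕ) → X)
    (h : ∀ j a, D j (G a) = G (a + Pi.single j 1)) (l : List (Fin n)) (α a : Fin n → ℕ) :
    l.foldr (fun j g => (D j)^[α j] g) (G a) =
      G (a + (l.map (fun j => Pi.single j (α j))).sum) := by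
  induction l with
  | nil => simp
  | cons k l ih =>
    simp only [List.foldr_cons, List.map_cons, List.sum_cons]
    rw [ih, iter_shift (D k) G k (h k)]
    congr 1
    abel

lemma sum_finRange_single {n : ℕ} (α : Fin n → ℕ) :
    ((List.finRange n).map (fun j => Pi.single (M := fun _ : Fin n => ℕ) j (α j))).sum = α := by
  have := Finset.univ_sum_single (M := fun _ : Fin n => ℕ) α
  rw [← Fin.sum_univ_def]
  exact this

lemma mdx_Fs {n : ℕ} {f : (Fin n → ℝ) → ℝ} (hf : ContDiff ℝ (⊤ : ℕ∞) f)
    (T : Finset (Fin n → ℕ)) (a b α : Fin n → ℕ) :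
    mdx α (Fs f T a b) = Fs f T (a + α) b := by
  have := foldr_shift (fun j => pdx j) (fun a => Fs f T a b) (fun j a => pdx_Fs hf T a b j)
    (List.finRange n) α a
  rw [sum_finRange_single] at this
  exact this

lemma mdy_Fs {n : ℕ} (f : (Fin n → ℝ) → ℝ)
    (T : Finset (Fin n → ℕ)) (a b β : Fin n → ℕ) :
    mdy β (Fs f T a b) = Fs f T a (b + β) := by
  have := foldr_shift (fun j => pdy j) (fun b => Fs f T a b) (fun j b => pdy_Fs f T a b j)
    (List.finRange n) β b
  rw [sum_finRange_single] at this
  exact this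

/-- multi-indices of length at most N -/
def Sset (n N : ℕ) : Finset (Fin n → ℕ) :=
  (Fintype.piFinset (fun _ : Fin n => Finset.range (N + 1))).filter (fun g => ∑ i, g i ≤ N)

lemma mem_Sset {n N : ℕ} (g : Fin n → ℕ) : g ∈ Sset n N ↔ ∑ i, g i ≤ N := by
  unfold Sset
  rw [Finset.mem_filter, Fintype.mem_piFinset]
  constructor
  · exact fun h => h.2
  · intro h
    refine ⟨fun i => ?_, h⟩
    have := Finset.single_le_sum (f := g) (fun i _ => Nat.zero_le _) (Finset.mem_univ i)
    rw [Finset.mem_range]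
    omega

lemma Ef_zero {n : ℕ} (g : Fin n → ℕ) (y : Fin n → ℝ) :
    Ef g 0 y = (∏ i, (Complex.I * (y i : ℂ)) ^ (g i)) / ((∏ i, Nat.factorial (g i) : ℕ) : ℂ) := by
  unfold Ef ef
  push_cast
  rw [← Finset.prod_div_distrib]
  simp

lemma aae_eq {n : ℕ} (N : ℕ) (f : (Fin n → ℝ) → ℝ) : aae N f = Fs f (Sset n N) 0 0 := by
  funext x y
  unfold aae Fs
  refine Finset.sum_bij (fun a _ => fun i => (a i : ℕ)) ?_ ?_ ?_ ?_
  · intro a ha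
    rw [mem_Sset]
    simpa using ha
  · intro a _ b _ h
    funext i
    exact Fin.ext (congrFun h i)
  · intro b hb
    have hb' := hb
    rw [mem_Sset] at hb'
    have hlt : ∀ i, b i < N + 1 := by
      intro i
      have := Finset.single_le_sum (f := b) (fun i _ => Nat.zero_le _) (Finset.mem_univ i)
      omega
    refine ⟨fun i => ⟨b i, hlt i⟩, ?_, ?_⟩
    · simpa using hb'
    · rfl
  · intro a _
    rw [Ef_zero, add_zero]

/-- multi-indices of length exactly N -/
def Tset (n N : ℕ) : Finset (Fin n → ℕ) := (Sset n N).filter (fun g => ∑ i, g i = N)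

lemma I_mul_Ef {n : ℕ} (g : Fin n → ℕ) (j : Fin n) (y : Fin n → ℝ) :
    Complex.I * Ef (g + Pi.single j 1) (0 + Pi.single j 1) y = - Ef g 0 y := by
  unfold Ef
  rw [← Finset.mul_prod_erase Finset.univ _ (Finset.mem_univ j),
    ← Finset.mul_prod_erase Finset.univ (fun i => ef (g i) ((0 : Fin n → ℕ) i) (y i)) (Finset.mem_univ j)]
  rw [← mul_assoc, ← neg_mul]
  congr 1
  · unfold ef
    have h1 : ((g j + 1 : ℕ) : ℂ) ≠ 0 := Nat.cast_ne_zero.2 (Nat.succ_ne_zero _)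
    have h2 : ((g j).factorial : ℂ) ≠ 0 := by exact_mod_cast Nat.factorial_ne_zero _
    simp only [Pi.add_apply, Pi.single_eq_same, Pi.zero_apply, zero_add, Nat.descFactorial_one,
      Nat.add_sub_cancel, Nat.factorial_succ, Nat.descFactorial_zero, Nat.sub_zero, pow_one, pow_zero]
    rw [Nat.cast_mul]
    field_simp
    rw [Complex.I_sq]
    push_cast
    ring
  · apply Finset.prod_congr rfl
    intro i hi
    have := Finset.ne_of_mem_erase hi
    simp [Pi.single_apply, this]

lemma Ef_single_zero {n : ℕ} (g : Fin n → ℕ) (j : Fin n) (y : Fin n → ℝ) (h : g j = 0) :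
    Ef g (0 + Pi.single j 1) y = 0 := by
  unfold Ef
  apply Finset.prod_eq_zero (Finset.mem_univ j)
  unfold ef
  simp [h]

lemma CR_eq {n : ℕ} (N : ℕ) (f : (Fin n → ℝ) → ℝ) (j : Fin n) (x y : Fin n → ℝ) :
    Fs f (Sset n N) (0 + Pi.single j 1) 0 x y + Complex.I * Fs f (Sset n N) 0 (0 + Pi.single j 1) x y
      = Fs f (Tset n N) (Pi.single j 1) 0 x y := by
  have key : Complex.I * Fs f (Sset n N) 0 (0 + Pi.single j 1) x y =
      - ∑ g ∈ (Sset n N).filter (fun g => ¬ ∑ i, g i = N),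
        Ef g 0 y * ((mderiv (g + Pi.single j 1) f x : ℝ) : ℂ) := by
    unfold Fs
    rw [Finset.mul_sum, ← Finset.sum_neg_distrib]
    rw [← Finset.sum_filter_add_sum_filter_not (Sset n N) (fun g => g j = 0)]
    rw [Finset.sum_eq_zero (s := (Sset n N).filter (fun g => g j = 0)), zero_add]
    · symm
      have hsum : ∀ g : Fin n → ℕ, ∑ i, (g + Pi.single j 1 : Fin n → ℕ) i = ∑ i, g i + 1 := by
        intro g
        simp [Finset.sum_add_distrib]
      refine Finset.sum_bij (fun g _ => g + Pi.single j 1) ?_ ?_ ?_ ?_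
      · intro g hg
        rw [Finset.mem_filter, mem_Sset] at hg ⊢
        rw [hsum]
        refine ⟨by omega, by simp⟩
      · intro g _ g' _ h
        exact add_right_cancel h
      · intro b hb
        rw [Finset.mem_filter, mem_Sset] at hb
        have hle : Pi.single j 1 ≤ b := by
          intro i
          by_cases hi : i = j
          · subst hi; simp; omega
          · simp [Pi.single_apply, hi]
        have hbb : b - Pi.single j 1 + Pi.single j 1 = b := tsub_add_cancel_of_le hle
        refine ⟨b - Pi.single j 1, ?_, hbb⟩
        rw [Finset.mem_filter, mem_Sset]
        have := hsum (b - Pi.single j 1)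
        rw [hbb] at this
        omega
      · intro g _
        rw [← mul_assoc, I_mul_Ef, add_zero, neg_mul]
    · intro g hg
      rw [Ef_single_zero g j y (Finset.mem_filter.1 hg).2]
      simp
  rw [key]
  unfold Fs Tset
  rw [← Finset.sum_filter_add_sum_filter_not (Sset n N) (fun g => ∑ i, g i = N)]
  simp

lemma main_eq {n : ℕ} (N : ℕ) {f : (Fin n → ℝ) → ℝ} (hf : ContDiff ℝ (⊤ : ℕ∞) f)
    (j : Fin n) (α β : Fin n → ℕ) :
    mdx α (mdy β (fun x' y' => pdx j (aae N f) x' y' + Complex.I * pdy j (aae N f) x' y')) =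
      Fs f (Tset n N) (Pi.single j 1 + α) β := by
  have : (fun x' y' => pdx j (aae N f) x' y' + Complex.I * pdy j (aae N f) x' y') =
      Fs f (Tset n N) (Pi.single j 1) 0 := by
    funext x y
    rw [aae_eq, pdx_Fs hf, pdy_Fs, CR_eq]
  rw [this, mdy_Fs, mdx_Fs hf, zero_add]

lemma card_Tset (n N : ℕ) : (Tset n N).card ≤ (N + 1) ^ n := by
  unfold Tset Sset
  refine (Finset.card_filter_le _ _).trans ((Finset.card_filter_le _ _).trans ?_)
  simp

lemma norm_ef_le (g b N : ℕ) (hg : g ≤ N) (t w : ℝ) (hw : 0 < w) (ht : |t| ≤ w) :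
    ‖ef g b t‖ ≤ (N : ℝ) ^ b * (w ^ g * (w ^ b)⁻¹) * ((g.factorial : ℝ))⁻¹ := by
  by_cases hb : b ≤ g
  · unfold ef
    rw [norm_div, norm_mul, norm_mul, norm_pow, norm_pow, norm_mul, Complex.norm_I, one_pow, one_mul,
      mul_one, Complex.norm_natCast, Complex.norm_natCast, Complex.norm_real, div_eq_mul_inv]
    rw [← pow_sub₀ w hw.ne' hb]
    have h1 : (g.descFactorial b : ℝ) ≤ (N : ℝ) ^ b := by
      have : g.descFactorial b ≤ N ^ b :=
        (Nat.descFactorial_le_pow g b).trans (Nat.pow_le_pow_left hg b)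
      exact_mod_cast this
    have h2 : ‖t‖ ^ (g - b) ≤ w ^ (g - b) := by
      apply pow_le_pow_left₀ (norm_nonneg _)
      exact ht
    gcongr
  · have : ef g b t = 0 := by
      unfold ef
      rw [Nat.descFactorial_of_lt (by omega)]
      simp
    rw [this, norm_zero]
    positivity

lemma norm_Ef_le {n : ℕ} (g b : Fin n → ℕ) (N : ℕ) (hg : ∑ i, g i = N) (y : Fin n → ℝ) (w : ℝ)
    (hw : 0 < w) (hy : ∀ k, |y k| < w) :
    ‖Ef g b y‖ ≤ (N : ℝ) ^ (∑ i, b i) * (w ^ N * (w ^ (∑ i, b i))⁻¹) *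
      (((∏ i, (g i).factorial : ℕ) : ℝ))⁻¹ := by
  unfold Ef
  rw [norm_prod]
  have : (N : ℝ) ^ (∑ i, b i) * (w ^ N * (w ^ (∑ i, b i))⁻¹) *
      (((∏ i, (g i).factorial : ℕ) : ℝ))⁻¹ =
      ∏ i, ((N : ℝ) ^ (b i) * (w ^ (g i) * (w ^ (b i))⁻¹) * (((g i).factorial : ℝ))⁻¹) := by
    simp only [Finset.prod_mul_distrib, Finset.prod_inv_distrib, Finset.prod_pow_eq_pow_sum, hg]
    push_cast
    rfl
  rw [this]
  apply Finset.prod_le_prod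
  · intro i _; exact norm_nonneg _
  · intro i _
    apply norm_ef_le _ _ _ _ _ _ hw (hy i).le
    rw [← hg]
    exact Finset.single_le_sum (f := g) (fun i _ => Nat.zero_le _) (Finset.mem_univ i)

lemma Ef_eq_zero {n : ℕ} (g b : Fin n → ℕ) (h : ∑ i, g i < ∑ i, b i) (y : Fin n → ℝ) :
    Ef g b y = 0 := by
  obtain ⟨i, _, hi⟩ := Finset.exists_lt_of_sum_lt h
  unfold Ef
  apply Finset.prod_eq_zero (Finset.mem_univ i)
  unfold ef
  rw [Nat.descFactorial_of_lt hi]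
  simp

lemma factorial_add_le (g d N k : ℕ) (hg : g ≤ N) (hd : d ≤ k) :
    (g + d).factorial ≤ g.factorial * (N + k) ^ d := by
  rw [← Nat.factorial_mul_ascFactorial]
  apply Nat.mul_le_mul_left
  refine (Nat.ascFactorial_le_pow_add _ _).trans ?_
  apply Nat.pow_le_pow_left
  omega

lemma prod_factorial_add_le {n : ℕ} (g d : Fin n → ℕ) (N k : ℕ) (hg : ∑ i, g i = N)
    (hd : ∑ i, d i = k) :
    ∏ i, (g i + d i).factorial ≤ (∏ i, (g i).factorial) * (N + k) ^ k := by
  have : (∏ i, (g i).factorial) * (N + k) ^ k = ∏ i, ((g i).factorial * (N + k) ^ (d i)) := by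
    rw [Finset.prod_mul_distrib, Finset.prod_pow_eq_pow_sum, hd]
  rw [this]
  apply Finset.prod_le_prod'
  intro i _
  apply factorial_add_le
  · rw [← hg]
    exact Finset.single_le_sum (f := g) (fun i _ => Nat.zero_le _) (Finset.mem_univ i)
  · rw [← hd]
    exact Finset.single_le_sum (f := d) (fun i _ => Nat.zero_le _) (Finset.mem_univ i)

lemma factorial_stirling (N : ℕ) :
    ((N + 1).factorial : ℝ) * Real.exp (N + 1 : ℕ) ≤ Real.exp 1 * ((N + 1 : ℕ) : ℝ) ^ (N + 2) := by
  induction N with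
  | zero => simp
  | succ N ih =>
    have h1 : Real.exp 1 * ((N + 1 : ℕ) : ℝ) ^ (N + 2) ≤ ((N + 2 : ℕ) : ℝ) ^ (N + 2) := by
      have hp : (0 : ℝ) < ((N + 2 : ℕ) : ℝ) := by positivity
      have h2 : ((N + 1 : ℕ) : ℝ) / ((N + 2 : ℕ) : ℝ) ≤ Real.exp (-(1 / ((N + 2 : ℕ) : ℝ))) := by
        have := Real.add_one_le_exp (-(1 / ((N + 2 : ℕ) : ℝ)))
        refine le_trans (le_of_eq ?_) this
        field_simp
        push_cast
        ring
      have h3 := pow_le_pow_left₀ (by positivity) h2 (N + 2)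
      rw [← Real.exp_nat_mul, div_pow, div_le_iff₀ (by positivity)] at h3
      have h4 : ((N + 2 : ℕ) : ℝ) * -(1 / ((N + 2 : ℕ) : ℝ)) = -1 := by field_simp
      rw [h4] at h3
      calc Real.exp 1 * ((N + 1 : ℕ) : ℝ) ^ (N + 2)
          ≤ Real.exp 1 * (Real.exp (-1) * ((N + 2 : ℕ) : ℝ) ^ (N + 2)) := by gcongr
        _ = ((N + 2 : ℕ) : ℝ) ^ (N + 2) := by
          rw [← mul_assoc, ← Real.exp_add]; simp
    have e1 : Real.exp ((N + 1 + 1 : ℕ) : ℝ) = Real.exp ((N + 1 : ℕ) : ℝ) * Real.exp 1 := by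
      rw [← Real.exp_add]; push_cast; rfl
    rw [Nat.factorial_succ, e1]
    calc (((N + 1 + 1) * (N + 1).factorial : ℕ) : ℝ) * (Real.exp ((N + 1 : ℕ) : ℝ) * Real.exp 1)
        = ((N + 2 : ℕ) : ℝ) * Real.exp 1 * (((N + 1).factorial : ℝ) * Real.exp ((N + 1 : ℕ) : ℝ)) := by
          push_cast; ring
      _ ≤ ((N + 2 : ℕ) : ℝ) * Real.exp 1 * (Real.exp 1 * ((N + 1 : ℕ) : ℝ) ^ (N + 2)) := by gcongr
      _ ≤ ((N + 2 : ℕ) : ℝ) * Real.exp 1 * ((N + 2 : ℕ) : ℝ) ^ (N + 2) := by gcongr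
      _ = Real.exp 1 * ((N + 1 + 1 : ℕ) : ℝ) ^ (N + 1 + 2) := by ring

/-- with N = floor M: N! ≤ e² (N+1) e^{-M} M^N -/
lemma factorial_floor_le (M : ℝ) (hM : 0 < M) :
    ((⌊M⌋₊).factorial : ℝ) ≤ Real.exp 2 * ((⌊M⌋₊ : ℝ) + 1) * Real.exp (-M) * M ^ ⌊M⌋₊ := by
  have hle : (⌊M⌋₊ : ℝ) ≤ M := Nat.floor_le hM.le
  have hlt : M < (⌊M⌋₊ : ℝ) + 1 := Nat.lt_floor_add_one M
  generalize ⌊M⌋₊ = N at *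
  cases N with
  | zero =>
    simp only [Nat.factorial_zero, Nat.cast_one, Nat.cast_zero, zero_add, mul_one, pow_zero]
    rw [← Real.exp_add]
    apply Real.one_le_exp
    simp at hlt
    linarith
  | succ N =>
    have h := factorial_stirling N
    have h1 : ((N + 1 : ℕ) : ℝ) ^ (N + 1) ≤ M ^ (N + 1) := pow_le_pow_left₀ (by positivity) hle _
    have h2 : Real.exp (-((N + 1 : ℕ) : ℝ)) ≤ Real.exp 1 * Real.exp (-M) := by
      rw [← Real.exp_add]; apply Real.exp_le_exp.2; linarith
    have h0 : Real.exp 2 = Real.exp 1 * Real.exp 1 := by rw [← Real.exp_add]; norm_num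
    calc ((N + 1).factorial : ℝ)
        = ((N + 1).factorial : ℝ) * Real.exp (N + 1 : ℕ) * Real.exp (-((N + 1 : ℕ) : ℝ)) := by
          rw [mul_assoc, ← Real.exp_add]; simp
      _ ≤ Real.exp 1 * ((N + 1 : ℕ) : ℝ) ^ (N + 2) * (Real.exp 1 * Real.exp (-M)) := by gcongr
      _ = Real.exp 2 * ((N + 1 : ℕ) : ℝ) * Real.exp (-M) * ((N + 1 : ℕ) : ℝ) ^ (N + 1) := by
          rw [h0]; ring
      _ ≤ Real.exp 2 * (((N + 1 : ℕ) : ℝ) + 1) * Real.exp (-M) * M ^ (N + 1) := by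
          gcongr; linarith

lemma one_le_jb {n : ℕ} (x : Fin n → ℝ) : 1 ≤ jb x := by
  unfold jb
  rw [Real.one_le_sqrt]
  have : 0 ≤ ∑ i, (x i) ^ 2 := Finset.sum_nonneg (fun i _ => sq_nonneg _)
  linarith

/-- (Rw)^N N!^{s-1} bound. -/
lemma gevrey_bound (s R w : ℝ) (hs : 1 < s) (hR : 0 < R) (hw : 0 < w) (N : ℕ)
    (hN : N = ⌊(R * w) ^ (-(1 / (s - 1)))⌋₊) :
    R ^ N * w ^ N * ((N.factorial : ℝ)) ^ (s - 1) ≤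
      Real.exp 2 ^ (s - 1) * ((N : ℝ) + 1) ^ (s - 1) *
        Real.exp (-(((s - 1) / R ^ (1 / (s - 1))) / w ^ (1 / (s - 1)))) := by
  set M : ℝ := (R * w) ^ (-(1 / (s - 1))) with hMdef
  have hs1 : 0 < s - 1 := by linarith
  have hRw : 0 < R * w := by positivity
  have hM : 0 < M := Real.rpow_pos_of_pos hRw _
  have hf := factorial_floor_le M hM
  rw [← hN] at hf
  have h1 : M ^ (s - 1) = (R * w)⁻¹ := by
    rw [hMdef, ← Real.rpow_mul hRw.le, ← Real.rpow_neg_one]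
    congr 1
    field_simp
  have h2 : (M ^ N) ^ (s - 1) = ((R * w) ^ N)⁻¹ := by
    rw [← Real.rpow_natCast M N, ← Real.rpow_mul hM.le, mul_comm, Real.rpow_mul hM.le, h1,
      Real.rpow_natCast, inv_pow]
  have h3 : Real.exp (-M) ^ (s - 1) =
      Real.exp (-(((s - 1) / R ^ (1 / (s - 1))) / w ^ (1 / (s - 1)))) := by
    rw [← Real.exp_mul]
    congr 1
    rw [hMdef, Real.rpow_neg hRw.le, Real.mul_rpow hR.le hw.le]
    have := Real.rpow_pos_of_pos hR (1 / (s - 1))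
    have := Real.rpow_pos_of_pos hw (1 / (s - 1))
    field_simp
  calc R ^ N * w ^ N * ((N.factorial : ℝ)) ^ (s - 1)
      ≤ R ^ N * w ^ N * (Real.exp 2 * ((N : ℝ) + 1) * Real.exp (-M) * M ^ N) ^ (s - 1) := by
        gcongr
    _ = R ^ N * w ^ N * (Real.exp 2 ^ (s - 1) * ((N : ℝ) + 1) ^ (s - 1) *
          Real.exp (-M) ^ (s - 1) * ((R * w) ^ N)⁻¹) := by
        rw [Real.mul_rpow (by positivity) (by positivity), Real.mul_rpow (by positivity) (by positivity),
          Real.mul_rpow (by positivity) (by positivity), h2]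
    _ = _ := by
        rw [h3]
        have : (R * w) ^ N = R ^ N * w ^ N := mul_pow _ _ _
        rw [this]
        field_simp

lemma term_bound (n : ℕ) (s R a C₀ : ℝ) (hs : 1 < s) (hR : 0 < R) (hC₀ : 0 < C₀)
    (f : (Fin n → ℝ) → ℝ)
    (hder : ∀ (α : Fin n → ℕ) (x : Fin n → ℝ),
      |mderiv α f x| ≤ C₀ * R ^ (∑ i, α i) * ((∏ i, Nat.factorial (α i) : ℕ) : ℝ) ^ s *
        jb x ^ (a - ((∑ i, α i : ℕ) : ℝ)))
    (d β g : Fin n → ℕ) (N k B : ℕ) (hk : ∑ i, d i = k) (hB : ∑ i, β i = B) (hg : ∑ i, g i = N)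
    (w : ℝ) (hw : 0 < w) (hN : N = ⌊(R * w) ^ (-(1 / (s - 1)))⌋₊)
    (x y : Fin n → ℝ) (hy : ∀ i, |y i| < w) :
    ‖Ef g β y * ((mderiv (g + d) f x : ℝ) : ℂ)‖ ≤
      C₀ * R ^ k * Real.exp 2 ^ (s - 1) * (w ^ B)⁻¹ *
        ((N : ℝ) ^ B * (((N : ℝ) + k) ^ k) ^ s * ((N : ℝ) + 1) ^ (s - 1)) *
        Real.exp (-(((s - 1) / R ^ (1 / (s - 1))) / w ^ (1 / (s - 1)))) *
        jb x ^ (a - k - B) := by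
  have hj1 := one_le_jb x
  have hj0 : 0 < jb x := by linarith
  by_cases hBN : N < B
  · rw [Ef_eq_zero g β (by omega)]
    simp only [zero_mul, norm_zero]
    positivity
  rw [norm_mul, Complex.norm_real]
  have h1 := norm_Ef_le g β N hg y w hw hy
  rw [hB] at h1
  have h2 := hder (g + d) x
  have hsum : ∑ i, (g + d) i = N + k := by
    simp [Finset.sum_add_distrib, hg, hk]
  rw [hsum] at h2
  set P : ℕ := ∏ i, (g i).factorial with hP
  have hP0 : 0 < P := Finset.prod_pos (fun i _ => Nat.factorial_pos _)
  have hP0' : (0 : ℝ) < P := by exact_mod_cast hP0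
  have hPN : P ≤ N.factorial := by
    rw [← hg]
    exact Nat.le_of_dvd (Nat.factorial_pos _) (Nat.prod_factorial_dvd_factorial_sum _ _)
  have h3 : ((∏ i, Nat.factorial ((g + d) i) : ℕ) : ℝ) ≤ (P : ℝ) * ((N : ℝ) + k) ^ k := by
    have := prod_factorial_add_le g d N k hg hk
    exact_mod_cast this
  have h4 : ((∏ i, Nat.factorial ((g + d) i) : ℕ) : ℝ) ^ s ≤ (P : ℝ) ^ s * (((N : ℝ) + k) ^ k) ^ s := by
    rw [← Real.mul_rpow (by positivity) (by positivity)]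
    exact Real.rpow_le_rpow (by positivity) h3 (by linarith)
  have h5 : jb x ^ (a - ((N + k : ℕ) : ℝ)) ≤ jb x ^ (a - k - B) := by
    apply Real.rpow_le_rpow_of_exponent_le hj1
    have : (B : ℝ) ≤ N := by exact_mod_cast (not_lt.1 hBN)
    push_cast
    linarith
  have h6 : (P : ℝ) ^ s = P * (P : ℝ) ^ (s - 1) := by
    rw [← Real.rpow_one_add' hP0'.le (by linarith)]
    congr 1; ring
  have h7 : (P : ℝ) ^ (s - 1) ≤ (N.factorial : ℝ) ^ (s - 1) := by
    apply Real.rpow_le_rpow hP0'.le (by exact_mod_cast hPN) (by linarith)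
  have h8 := gevrey_bound s R w hs hR hw N hN
  calc ‖Ef g β y‖ * ‖mderiv (g + d) f x‖
      ≤ ((N : ℝ) ^ B * (w ^ N * (w ^ B)⁻¹) * (P : ℝ)⁻¹) *
        (C₀ * R ^ (N + k) * ((P * (P : ℝ) ^ (s - 1)) * (((N : ℝ) + k) ^ k) ^ s) *
          jb x ^ (a - k - B)) := by
        apply mul_le_mul h1 _ (norm_nonneg _) (by positivity)
        refine h2.trans ?_
        rw [← h6]
        gcongr
    _ = (C₀ * R ^ k * (w ^ B)⁻¹ * ((N : ℝ) ^ B * (((N : ℝ) + k) ^ k) ^ s) * jb x ^ (a - k - B)) *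
          (R ^ N * w ^ N * (P : ℝ) ^ (s - 1)) := by
        rw [pow_add]
        field_simp
    _ ≤ (C₀ * R ^ k * (w ^ B)⁻¹ * ((N : ℝ) ^ B * (((N : ℝ) + k) ^ k) ^ s) * jb x ^ (a - k - B)) *
          (Real.exp 2 ^ (s - 1) * ((N : ℝ) + 1) ^ (s - 1) *
        Real.exp (-(((s - 1) / R ^ (1 / (s - 1))) / w ^ (1 / (s - 1))))) := by
        apply mul_le_mul_of_nonneg_left _ (by positivity)
        refine le_trans ?_ h8
        gcongr
    _ = _ := by ring

lemma poly_bound (n B k N : ℕ) (s : ℝ) (hs : 1 < s) :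
    ((N : ℝ) + 1) ^ n * ((N : ℝ) ^ B * (((N : ℝ) + k) ^ k) ^ s * ((N : ℝ) + 1) ^ (s - 1)) ≤
      ((N : ℝ) + k + 1) ^ ((n : ℝ) + B + k * s + (s - 1)) := by
  set Q : ℝ := (N : ℝ) + k + 1 with hQ
  have hN : (0 : ℝ) ≤ N := by positivity
  have hk : (0 : ℝ) ≤ k := by positivity
  have hQ0 : 0 < Q := by positivity
  rw [Real.rpow_add hQ0, Real.rpow_add hQ0, Real.rpow_add hQ0, Real.rpow_natCast, Real.rpow_natCast,
    Real.rpow_mul hQ0.le, Real.rpow_natCast]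
  have a1 : (N : ℝ) + 1 ≤ Q := by linarith
  have a2 : (N : ℝ) ≤ Q := by linarith
  have a3 : (N : ℝ) + k ≤ Q := by linarith
  have hs1 : 0 ≤ s - 1 := by linarith
  have hs0 : 0 ≤ s := by linarith
  calc _ ≤ Q ^ n * (Q ^ B * (Q ^ k) ^ s * Q ^ (s - 1)) := by gcongr
    _ = _ := by ring

/-- The Cauchy–Riemann derivatives of the almost analytic extension are
    exponentially small as w → 0: with N = ⌊(Rw)^{-1/(s-1)}⌋ and Ω = (s-1)/R^{1/(s-1)},
    |∂_x^α ∂_y^β (∂_{x_j}+i∂_{y_j}) f̃| ≤ C w^{-l} exp(−Ω/w^{1/(s-1)}) ⟨x⟩^{a−|α+β|−1} on S_w. -/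
theorem stmt9 (n : ℕ) (s R a C₀ : ℝ) (hs : 1 < s) (hR : 0 < R) (hC₀ : 0 < C₀)
    (f : (Fin n → ℝ) → ℝ) (hf : ContDiff ℝ (⊤ : ℕ∞) f)
    (hder : ∀ (α : Fin n → ℕ) (x : Fin n → ℝ),
      |mderiv α f x| ≤ C₀ * R ^ (∑ i, α i) * ((∏ i, Nat.factorial (α i) : ℕ) : ℝ) ^ s *
        jb x ^ (a - ((∑ i, α i : ℕ) : ℝ))) :
    ∀ (j : Fin n) (α β : Fin n → ℕ), ∃ C : ℝ, 0 < C ∧ ∃ l : ℝ, 0 < l ∧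
      ∀ w : ℝ, 0 < w → w ≤ 1 → ∀ x y : Fin n → ℝ, (∀ k, |y k| < w) →
        ‖mdx α (mdy β (fun x' y' =>
            pdx j (aae (Nat.floor ((R * w) ^ (-(1 / (s - 1))) : ℝ)) f) x' y' +
            Complex.I * pdy j (aae (Nat.floor ((R * w) ^ (-(1 / (s - 1))) : ℝ)) f) x' y')) x y‖ ≤
          C * w ^ (-l) * Real.exp (-(((s - 1) / R ^ (1 / (s - 1))) / w ^ (1 / (s - 1)))) *
            jb x ^ (a - ((∑ i, (α i + β i) : ℕ) : ℝ) - 1) := by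
  intro j α β
  obtain ⟨k, hk⟩ : ∃ k, ∑ i, (Pi.single j 1 + α : Fin n → ℕ) i = k := ⟨_, rfl⟩
  obtain ⟨B, hB⟩ : ∃ B, ∑ i, β i = B := ⟨_, rfl⟩
  have hkα : k = 1 + ∑ i, α i := by
    rw [← hk]; simp [Finset.sum_add_distrib]
  have hs1 : 0 < s - 1 := by linarith
  set p : ℝ := (n : ℝ) + B + k * s + (s - 1) with hp
  have hp0 : 0 < p := by positivity
  set K : ℝ := R ^ (-(1 / (s - 1))) + k + 1 with hK
  have hRp : 0 < R ^ (-(1 / (s - 1))) := Real.rpow_pos_of_pos hR _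
  have hK0 : 0 < K := by positivity
  refine ⟨C₀ * R ^ k * Real.exp 2 ^ (s - 1) * K ^ p, by positivity, (B : ℝ) + (1 / (s - 1)) * p,
    by positivity, ?_⟩
  intro w hw hw1 x y hy
  obtain ⟨N, hN⟩ : ∃ N, N = ⌊(R * w) ^ (-(1 / (s - 1)))⌋₊ := ⟨_, rfl⟩
  rw [← hN, main_eq N hf]
  have hj0 : 0 < jb x := by have := one_le_jb x; linarith
  have hexp : a - ((∑ i, (α i + β i) : ℕ) : ℝ) - 1 = a - k - B := by
    rw [Finset.sum_add_distrib, hB, hkα]; push_cast; ring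
  rw [hexp]
  have hQ : (N : ℝ) + k + 1 ≤ K * w ^ (-(1 / (s - 1))) := by
    have h1 : (N : ℝ) ≤ (R * w) ^ (-(1 / (s - 1))) := by
      rw [hN]; exact Nat.floor_le (by positivity)
    rw [Real.mul_rpow hR.le hw.le] at h1
    have h2 : 1 ≤ w ^ (-(1 / (s - 1))) := by
      apply Real.one_le_rpow_of_pos_of_le_one_of_nonpos hw hw1
      have : 0 < 1 / (s - 1) := by positivity
      linarith
    have h3 : (k : ℝ) + 1 ≤ (k + 1) * w ^ (-(1 / (s - 1))) := le_mul_of_one_le_right (by positivity) h2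
    rw [hK]
    linarith
  have hQp : ((N : ℝ) + k + 1) ^ p ≤ K ^ p * w ^ (-((1 / (s - 1)) * p)) := by
    refine (Real.rpow_le_rpow (by positivity) hQ hp0.le).trans (le_of_eq ?_)
    rw [Real.mul_rpow hK0.le (by positivity), ← Real.rpow_mul hw.le, neg_mul]
  have hwl : w ^ (-((B : ℝ) + (1 / (s - 1)) * p)) = (w ^ B)⁻¹ * w ^ (-((1 / (s - 1)) * p)) := by
    rw [neg_add, Real.rpow_add hw, Real.rpow_neg hw.le, Real.rpow_natCast]
  rw [hwl]
  set E := Real.exp (-(((s - 1) / R ^ (1 / (s - 1))) / w ^ (1 / (s - 1)))) with hE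
  have hE0 : 0 < E := Real.exp_pos _
  unfold Fs
  refine (norm_sum_le _ _).trans ?_
  refine (Finset.sum_le_card_nsmul _ _ _ (fun g hg => term_bound n s R a C₀ hs hR hC₀ f hder
    (Pi.single j 1 + α) β g N k B hk hB (Finset.mem_filter.1 hg).2 w hw hN x y hy)).trans ?_
  rw [nsmul_eq_mul]
  have hcard : ((Tset n N).card : ℝ) ≤ ((N : ℝ) + 1) ^ n := by
    exact_mod_cast card_Tset n N
  have hpoly := (poly_bound n B k N s hs).trans hQp
  rw [← hE]
  have hX : 0 ≤ (N : ℝ) ^ B * (((N : ℝ) + k) ^ k) ^ s * ((N : ℝ) + 1) ^ (s - 1) := by positivity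
  have hJ : 0 < jb x ^ (a - k - B) := Real.rpow_pos_of_pos hj0 _
  calc _ ≤ ((N : ℝ) + 1) ^ n * (C₀ * R ^ k * Real.exp 2 ^ (s - 1) * (w ^ B)⁻¹ *
        ((N : ℝ) ^ B * (((N : ℝ) + k) ^ k) ^ s * ((N : ℝ) + 1) ^ (s - 1)) * E *
        jb x ^ (a - k - B)) := by
        apply mul_le_mul_of_nonneg_right hcard
        positivity
    _ = (C₀ * R ^ k * Real.exp 2 ^ (s - 1) * (w ^ B)⁻¹ * E * jb x ^ (a - k - B)) *
        (((N : ℝ) + 1) ^ n *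
          ((N : ℝ) ^ B * (((N : ℝ) + k) ^ k) ^ s * ((N : ℝ) + 1) ^ (s - 1))) := by ring
    _ ≤ (C₀ * R ^ k * Real.exp 2 ^ (s - 1) * (w ^ B)⁻¹ * E * jb x ^ (a - k - B)) *
        (K ^ p * w ^ (-((1 / (s - 1)) * p))) := by
        apply mul_le_mul_of_nonneg_left hpoly
        positivity
    _ = _ := by ring
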